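/- arXiv:2209.08383 — 2 statements merged into one kernel-verified Lean document; each statement's English description precedes it below -/
import Mathlib

section
/- Forward Refinement Algorithm invariant: Let N be an NFA with vertex type V, let L₀ be a partition of V such that the member of L₀ containing the starting vertex v₀ is the singleton {v₀}, and define partitions iteratively by letting L_{i+1} be the common refinement of L_i by the family of sets Z[σ] for all Z ∈ L_i and σ : Option A (i.e. v and w lie in the same member of L_{i+1} iff they lie in the same member of L_i and, for each Z ∈ L_i and σ, v ∈ Z[σ] iff w ∈ Z[σ]). Then for every i and every sequence τ : List (Option A) of length i, letting R(τ) := {w | w is reachable on τ}, every Z ∈ L_i satisfies Z ⊆ R(τ) or Z ∩ R(τ) = ∅. -/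
/-- An NFA with accepting actions: vertices `V`, alphabet `A` (edge labels in
`Option A`, with `none` the ε-label), accepting actions `T` with a conflict
relation, starting vertex, edge relation, and accepting-action assignment. -/
structure NFAA (V A T : Type*) where
  start : V
  edge : V → Option A → V → Prop
  conf : T → T → Prop
  act : V → Set T

variable {V A T : Type*}

/-- `w` is reachable from `v` on the sequence `τ`. -/
def NFAA.ReachFrom (N : NFAA V A T) : V → List (Option A) → V → Prop
  | v, [], w => v = w
  | v, σ :: τ, w => ∃ u : V, N.edge v σ u ∧ N.ReachFrom u τ w

/-- `w` is reachable (from the starting vertex) on the sequence `τ`. -/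
def NFAA.Reach (N : NFAA V A T) (τ : List (Option A)) (w : V) : Prop :=
  N.ReachFrom N.start τ w

/-- A conflict: two sequences with equal strings, reaching vertices carrying
conflicting actions. -/
def NFAA.HasConflict (N : NFAA V A T) : Prop :=
  ∃ τ τ' : List (Option A), ∃ w w' : V, ∃ a a' : T,
    τ.filterMap id = τ'.filterMap id ∧
    N.Reach τ w ∧ N.Reach τ' w' ∧
    a ∈ N.act w ∧ a' ∈ N.act w' ∧ N.conf a a'

/-- The grouped NFA `N/∼` for an equivalence relation (setoid) `s` on `V`. -/
def NFAA.group (N : NFAA V A T) (s : Setoid V) : NFAA (Quotient s) A T where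
  start := Quotient.mk s N.start
  edge c σ d := ∃ v w : V, Quotient.mk s v = c ∧ Quotient.mk s w = d ∧ N.edge v σ w
  conf := N.conf
  act c := {a : T | ∃ v : V, Quotient.mk s v = c ∧ a ∈ N.act v}

/-- Forward equivalence: reachable from the start on exactly the same sequences. -/
def NFAA.FwdEquiv (N : NFAA V A T) (v₁ v₂ : V) : Prop :=
  ∀ τ : List (Option A), N.Reach τ v₁ ↔ N.Reach τ v₂

/-- Backward equivalence with respect to an initial partition `L0`. -/
def NFAA.BwdEquiv (N : NFAA V A T) (L0 : Set (Set V)) (v₁ v₂ : V) : Prop :=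
  ∀ Z ∈ L0, ∀ τ : List (Option A),
    (∃ w ∈ Z, N.ReachFrom v₁ τ w) ↔ (∃ w ∈ Z, N.ReachFrom v₂ τ w)

/-- A partition of `V`: pairwise disjoint nonempty subsets whose union is `V`. -/
def IsPartitionOf (L : Set (Set V)) : Prop :=
  (∀ Z ∈ L, Z.Nonempty) ∧
  (∀ Z ∈ L, ∀ Z' ∈ L, Z ≠ Z' → Z ∩ Z' = ∅) ∧
  ⋃₀ L = Set.univ

/-- `L` refines `L0`: every member of `L` is contained in some member of `L0`. -/
def RefinesPartition (L L0 : Set (Set V)) : Prop :=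
  ∀ Y ∈ L, ∃ Z ∈ L0, Y ⊆ Z

/-- The forward image `Z[σ]`. -/
def NFAA.fwdImg (N : NFAA V A T) (Z : Set V) (σ : Option A) : Set V :=
  {w : V | ∃ z ∈ Z, N.edge z σ w}

/-- The backward image `Z⁻[σ]`. -/
def NFAA.bwdImg (N : NFAA V A T) (Z : Set V) (σ : Option A) : Set V :=
  {z : V | ∃ w ∈ Z, N.edge z σ w}

/-- `L` is forward-stable. -/
def NFAA.FwdStable (N : NFAA V A T) (L : Set (Set V)) : Prop :=
  ∀ Z ∈ L, ∀ σ : Option A, ∀ Y ∈ L,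
    Y ⊆ N.fwdImg Z σ ∨ Y ∩ N.fwdImg Z σ = ∅

/-- `L` is backward-stable. -/
def NFAA.BwdStable (N : NFAA V A T) (L : Set (Set V)) : Prop :=
  ∀ Z ∈ L, ∀ σ : Option A, ∀ Y ∈ L,
    Y ⊆ N.bwdImg Z σ ∨ Y ∩ N.bwdImg Z σ = ∅

/-- `L0` is backward-admissible. -/
def NFAA.BwdAdmissible (N : NFAA V A T) (L0 : Set (Set V)) : Prop :=
  ∀ Z ∈ L0, ∀ Z' ∈ L0,
    (∃ w₁ ∈ Z, ∃ w₂ ∈ Z', ∃ a ∈ N.act w₁, ∃ a' ∈ N.act w₂, N.conf a a') →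
    ∀ v₁ ∈ Z, ∀ v₂ ∈ Z', ∃ a ∈ N.act v₁, ∃ a' ∈ N.act v₂, N.conf a a'

/-- One step of the forward refinement algorithm: the common refinement of
`L` by the sets `Z[σ]` for `Z ∈ L` and labels `σ`; vertices `v, w` lie in
the same member iff they lie in the same member of `L` and agree on
membership in each `Z[σ]`. -/
def fwdRefineStep (N : NFAA V A T) (L : Set (Set V)) : Set (Set V) :=
  {Y : Set V | Y.Nonempty ∧ ∃ v : V,
    Y = {w : V | (∃ Z ∈ L, v ∈ Z ∧ w ∈ Z) ∧
          ∀ Z ∈ L, ∀ σ : Option A, (v ∈ N.fwdImg Z σ ↔ w ∈ N.fwdImg Z σ)}}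

/-- The iterated partitions of the forward refinement algorithm. -/
def fwdRefineSeq (N : NFAA V A T) (L0 : Set (Set V)) : ℕ → Set (Set V)
  | 0 => L0
  | i + 1 => fwdRefineStep N (fwdRefineSeq N L0 i)

theorem NFAA.reachFrom_append_singleton (N : NFAA V A T) (v w : V) (τ : List (Option A))
    (σ : Option A) :
    N.ReachFrom v (τ ++ [σ]) w ↔ ∃ u, N.ReachFrom v τ u ∧ N.edge u σ w := by
  induction τ generalizing v with
  | nil => simp [NFAA.ReachFrom]
  | cons ρ τ ih =>
    simp only [List.cons_append, NFAA.ReachFrom, ih]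
    grind

theorem exists_mem_fwdRefineSeq (N : NFAA V A T) {L0 : Set (Set V)} (hL0 : ⋃₀ L0 = Set.univ)
    (i : ℕ) (v : V) : ∃ Z ∈ fwdRefineSeq N L0 i, v ∈ Z := by
  induction i with
  | zero => exact Set.mem_sUnion.mp (hL0 ▸ Set.mem_univ v)
  | succ i ih =>
    obtain ⟨Z, hZ, hv⟩ := ih
    have hmem : v ∈ {w : V | (∃ Z ∈ fwdRefineSeq N L0 i, v ∈ Z ∧ w ∈ Z) ∧
        ∀ Z ∈ fwdRefineSeq N L0 i, ∀ σ : Option A,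
          (v ∈ N.fwdImg Z σ ↔ w ∈ N.fwdImg Z σ)} :=
      ⟨⟨Z, hZ, hv, hv⟩, fun _ _ _ => Iff.rfl⟩
    exact ⟨_, ⟨⟨v, hmem⟩, v, rfl⟩, hmem⟩

theorem mem_fwdImg_iff_of_mem_fwdRefineStep {N : NFAA V A T} {L : Set (Set V)} {Y Z : Set V}
    (hY : Y ∈ fwdRefineStep N L) (hZ : Z ∈ L) {v w : V} (hv : v ∈ Y) (hw : w ∈ Y)
    (σ : Option A) : v ∈ N.fwdImg Z σ ↔ w ∈ N.fwdImg Z σ := by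
  obtain ⟨-, x, rfl⟩ := hY
  exact (hv.2 Z hZ σ).symm.trans (hw.2 Z hZ σ)

/-- **Forward Refinement Algorithm invariant.** At step `i`, every member of
`L_i` is either contained in or disjoint from the set of vertices reachable
on any sequence of length `i`. -/
theorem fwd_refinement_algorithm_invariant (N : NFAA V A T) (L0 : Set (Set V))
    (hpart : IsPartitionOf L0)
    (hstart : ∀ Z ∈ L0, N.start ∈ Z → Z = {N.start}) :
    ∀ (i : ℕ) (τ : List (Option A)), τ.length = i →
      ∀ Z ∈ fwdRefineSeq N L0 i,
        Z ⊆ {w : V | N.Reach τ w} ∨ Z ∩ {w : V | N.Reach τ w} = ∅ := by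
  intro i
  induction i with
  | zero =>
    intro τ hτ Z hZ
    obtain rfl := List.length_eq_zero_iff.mp hτ
    by_cases hs : N.start ∈ Z
    · left
      rw [hstart Z hZ hs]
      rintro w rfl
      exact rfl
    · right
      refine Set.eq_empty_iff_forall_notMem.mpr ?_
      rintro w ⟨hwZ, hw⟩
      have hw' : N.start = w := hw
      exact hs (hw' ▸ hwZ)
  | succ i ih =>
    intro τ hτ Y hY
    obtain ⟨τ, σ, rfl⟩ := List.eq_nil_or_concat' τ |>.resolve_left (by rintro rfl; simp at hτ)
    have hlen : τ.length = i := by simpa using hτ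
    refine or_iff_not_imp_right.mpr fun hne => ?_
    obtain ⟨v, hvY, hv⟩ := Set.nonempty_iff_ne_empty.mpr hne
    obtain ⟨u, hu, huv⟩ := (N.reachFrom_append_singleton _ _ _ _).mp hv
    obtain ⟨Z, hZ, huZ⟩ := exists_mem_fwdRefineSeq N hpart.2.2 i u
    have hZR : Z ⊆ {w : V | N.Reach τ w} :=
      (ih τ hlen Z hZ).resolve_right (Set.Nonempty.ne_empty ⟨u, huZ, hu⟩)
    intro w hwY
    obtain ⟨z, hz, hzw⟩ :=
      (mem_fwdImg_iff_of_mem_fwdRefineStep hY hZ hvY hwY σ).mp ⟨u, huZ, huv⟩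
    exact (N.reachFrom_append_singleton _ _ _ _).mpr ⟨z, hZR hz, hzw⟩
end

section
/- Backward partition grouping preserves conflicts: Let N be an NFA with vertex type V, let L0 be a backward-admissible partition of V, and let L be a partition of V that refines L0 and is backward-stable. Let ≈ be the equivalence relation induced by L (v ≈ w iff v and w lie in the same member of L). Then the grouped NFA N/≈ has a conflict if and only if N has a conflict. -/
variable {V A T : Type*}

/-- Reachability is preserved by passing to the grouped NFA. -/
theorem NFAA.ReachFrom.group {N : NFAA V A T} (s : Setoid V) {τ : List (Option A)} {v w : V}
    (h : N.ReachFrom v τ w) :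
    (N.group s).ReachFrom (Quotient.mk s v) τ (Quotient.mk s w) := by
  induction τ generalizing v with
  | nil => exact congrArg _ h
  | cons σ τ ih =>
    obtain ⟨u, hvu, hu⟩ := h
    exact ⟨Quotient.mk s u, ⟨v, u, rfl, rfl, hvu⟩, ih hu⟩

/-- Backward stability lets an edge be transported along equivalence of sources. -/
theorem NFAA.BwdStable.exists_edge {N : NFAA V A T} {L : Set (Set V)} (hpart : IsPartitionOf L)
    (hstable : N.BwdStable L) {s : Setoid V}
    (hs : ∀ v w : V, s.r v w ↔ ∃ Y ∈ L, v ∈ Y ∧ w ∈ Y) {v v' w : V} {σ : Option A}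
    (hv : s.r v v') (h : N.edge v σ w) : ∃ w', s.r w w' ∧ N.edge v' σ w' := by
  obtain ⟨Y, hY, hvY, hvY'⟩ := (hs v v').1 hv
  obtain ⟨Z, hZ, hwZ⟩ : w ∈ ⋃₀ L := hpart.2.2 ▸ Set.mem_univ w
  have hmem : v ∈ N.bwdImg Z σ := ⟨w, hwZ, h⟩
  rcases hstable Z hZ σ Y hY with hsub | hdisj
  · obtain ⟨w', hwZ', he⟩ := hsub hvY'
    exact ⟨w', (hs w w').2 ⟨Z, hZ, hwZ, hwZ'⟩, he⟩
  · exact absurd (show v ∈ Y ∩ N.bwdImg Z σ from ⟨hvY, hmem⟩) (by simp [hdisj])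

/-- If edges can be transported along equivalence of sources, then paths of the grouped NFA
lift to the original NFA. -/
theorem NFAA.ReachFrom.exists_lift {N : NFAA V A T} {s : Setoid V}
    (hedge : ∀ v v' w : V, ∀ σ : Option A, s.r v v' → N.edge v σ w →
      ∃ w', s.r w w' ∧ N.edge v' σ w')
    {τ : List (Option A)} {v : V} {c : Quotient s}
    (h : (N.group s).ReachFrom (Quotient.mk s v) τ c) :
    ∃ w, Quotient.mk s w = c ∧ N.ReachFrom v τ w := by
  induction τ generalizing v with
  | nil => exact ⟨v, h, rfl⟩
  | cons σ τ ih =>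
    obtain ⟨d, ⟨x, y, hx, rfl, hxy⟩, hd⟩ := h
    obtain ⟨u, hyu, hvu⟩ := hedge x v y σ (Quotient.exact hx) hxy
    rw [show Quotient.mk s y = Quotient.mk s u from Quotient.sound hyu] at hd
    obtain ⟨w, hw, huw⟩ := ih hd
    exact ⟨w, hw, u, hvu, huw⟩

/-- **Backward partition grouping preserves conflicts.** Grouping by the
equivalence relation induced by a backward-stable partition refining a
backward-admissible partition preserves the existence of conflicts. -/
theorem bwd_partition_grouping_preserves_conflicts (N : NFAA V A T)
    (L0 L : Set (Set V)) (hpart0 : IsPartitionOf L0)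
    (hadm : N.BwdAdmissible L0) (hpart : IsPartitionOf L)
    (hrefines : RefinesPartition L L0) (hstable : N.BwdStable L)
    (s : Setoid V)
    (hs : ∀ v w : V, s.r v w ↔ ∃ Y ∈ L, v ∈ Y ∧ w ∈ Y) :
    (N.group s).HasConflict ↔ N.HasConflict := by
  constructor
  · rintro ⟨τ, τ', c, c', a, a', hτ, hc, hc', ⟨x, hx, ha⟩, ⟨x', hx', ha'⟩, hconf⟩
    have hedge := fun v v' w σ (hv : s.r v v') (h : N.edge v σ w) =>
      hstable.exists_edge hpart hs hv h
    obtain ⟨w, rfl, hw⟩ := NFAA.ReachFrom.exists_lift hedge hc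
    obtain ⟨w', rfl, hw'⟩ := NFAA.ReachFrom.exists_lift hedge hc'
    obtain ⟨Y, hY, hxY, hwY⟩ := (hs x w).1 (Quotient.exact hx)
    obtain ⟨Y', hY', hxY', hwY'⟩ := (hs x' w').1 (Quotient.exact hx')
    obtain ⟨Z, hZ, hYZ⟩ := hrefines Y hY
    obtain ⟨Z', hZ', hYZ'⟩ := hrefines Y' hY'
    obtain ⟨b, hb, b', hb', hbb'⟩ := hadm Z hZ Z' hZ'
      ⟨x, hYZ hxY, x', hYZ' hxY', a, ha, a', ha', hconf⟩ w (hYZ hwY) w' (hYZ' hwY')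
    exact ⟨τ, τ', w, w', b, b', hτ, hw, hw', hb, hb', hbb'⟩
  · rintro ⟨τ, τ', w, w', a, a', hτ, hw, hw', ha, ha', hconf⟩
    exact ⟨τ, τ', _, _, a, a', hτ, hw.group s, hw'.group s, ⟨w, rfl, ha⟩, ⟨w', rfl, ha'⟩, hconf⟩
end
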